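/- arXiv:2410.13058 — 8 statements merged into one kernel-verified Lean document; each statement's English description precedes it below -/
import Mathlib

section
/- Let n ≥ 2 and a₁ be real numbers with 0 < a₁ < 1. Then the quadratic equation (3n − 2a₁(n+1)) y² − 4n y + 4a₁(n+1) = 0 admits a real solution y > 0 if and only if a₁ ≤ n/(2(n+1)) or a₁ ≥ n/(n+1). -/
theorem stmt_1 (n a₁ : ℝ) (hn : 2 ≤ n) (ha₀ : 0 < a₁) (ha₁ : a₁ < 1) :
    (∃ y : ℝ, 0 < y ∧
        (3 * n - 2 * a₁ * (n + 1)) * y ^ 2 - 4 * n * y + 4 * a₁ * (n + 1) = 0) ↔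
      a₁ ≤ n / (2 * (n + 1)) ∨ n / (n + 1) ≤ a₁ := by
  rw [le_div_iff₀ (by linarith), div_le_iff₀ (by linarith)]
  have hA : 0 < 3 * n - 2 * a₁ * (n + 1) := by nlinarith
  constructor
  · rintro ⟨y, -, h⟩
    have hsq : ((3 * n - 2 * a₁ * (n + 1)) * y - 2 * n) ^ 2
        = 4 * ((n - a₁ * (n + 1)) * (n - 2 * (a₁ * (n + 1)))) := by
      linear_combination (3 * n - 2 * a₁ * (n + 1)) * h
    by_contra! hlt
    have hneg : (n - a₁ * (n + 1)) * (n - 2 * (a₁ * (n + 1))) < 0 :=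
      mul_neg_of_pos_of_neg (by linarith) (by linarith)
    linarith [sq_nonneg ((3 * n - 2 * a₁ * (n + 1)) * y - 2 * n)]
  · intro h
    have hD : 0 ≤ (n - a₁ * (n + 1)) * (n - 2 * (a₁ * (n + 1))) := by
      rcases h with h | h
      · exact mul_nonneg (by linarith) (by linarith)
      · exact mul_nonneg_of_nonpos_of_nonpos (by linarith) (by linarith)
    have hs := Real.sq_sqrt hD
    set s := √((n - a₁ * (n + 1)) * (n - 2 * (a₁ * (n + 1))))
    have hs₀ : 0 ≤ s := Real.sqrt_nonneg _
    refine ⟨(2 * n + 2 * s) / (3 * n - 2 * a₁ * (n + 1)), div_pos (by linarith) hA, ?_⟩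
    have hne := hA.ne'
    field_simp
    linear_combination 4 * hs
end

section
/- The quartic polynomial p(x) = (69460352/387420489) x⁴ − (1018001920/1162261467) x³ + (116920960/129140163) x² − (1464320/4782969) x + 30976/531441 has exactly two distinct real roots. -/
theorem stmt_3 :
    {x : ℝ | (69460352 / 387420489 : ℝ) * x ^ 4 - (1018001920 / 1162261467) * x ^ 3
        + (116920960 / 129140163) * x ^ 2 - (1464320 / 4782969) * x
        + 30976 / 531441 = 0}.encard = 2 := by
  set f : ℝ → ℝ := fun x ↦ (69460352 / 387420489 : ℝ) * x ^ 4
    - (1018001920 / 1162261467) * x ^ 3 + (116920960 / 129140163) * x ^ 2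
    - (1464320 / 4782969) * x + 30976 / 531441 with hf
  have hcont : Continuous f := by fun_prop
  obtain ⟨a, ⟨ha₁, ha₂⟩, ha⟩ : (0 : ℝ) ∈ f '' Set.Icc (7 / 8) (9 / 10) :=
    intermediate_value_Icc' (by norm_num) hcont.continuousOn (by norm_num [hf])
  obtain ⟨b, ⟨hb₁, hb₂⟩, hb⟩ : (0 : ℝ) ∈ f '' Set.Icc (18 / 5) (37 / 10) :=
    intermediate_value_Icc (by norm_num) hcont.continuousOn (by norm_num [hf])
  rw [Set.encard_eq_two]
  refine ⟨a, b, by linarith, Set.Subset.antisymm (fun x hx ↦ ?_) ?_⟩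
  · change f x = 0 at hx
    have hfactor (y : ℝ) : f x - f y = (x - y) * ((69460352 / 387420489) *
        (x ^ 3 + x ^ 2 * y + x * y ^ 2 + y ^ 3) - (1018001920 / 1162261467) *
        (x ^ 2 + x * y + y ^ 2) + (116920960 / 129140163) * (x + y) - 1464320 / 4782969) := by
      simp only [hf]; ring
    have hxa := hfactor a
    have hxb := hfactor b
    rw [hx, ha, sub_self, eq_comm, mul_eq_zero, sub_eq_zero] at hxa
    rw [hx, hb, sub_self, eq_comm, mul_eq_zero, sub_eq_zero] at hxb
    rcases hxa with h | hxa
    · exact Or.inl h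
    rcases hxb with h | hxb
    · exact Or.inr h
    exfalso
    simp only [hf] at hx
    rcases le_total x (9 / 20) with h₁ | h₁
    · nlinarith [sq_nonneg (x * (x - 27 / 100)), sq_nonneg (x - 27 / 100),
        mul_nonneg (sub_nonneg.2 h₁) (sq_nonneg (x - 27 / 100))]
    rcases le_total x (7 / 8) with h₂ | h₂
    · nlinarith [mul_nonneg (sub_nonneg.2 h₁) (sub_nonneg.2 h₂), sq_nonneg (x - 9 / 20),
        mul_nonneg (mul_nonneg (sub_nonneg.2 h₁) (sub_nonneg.2 h₂)) (sub_nonneg.2 h₁),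
        mul_nonneg (mul_nonneg (sub_nonneg.2 h₁) (sub_nonneg.2 h₂)) (sub_nonneg.2 h₂),
        sq_nonneg ((x - 9 / 20) * (x - 7 / 8))]
    rcases le_total x (9 / 10) with h₃ | h₃
    · have hxx : x * x ≤ 81 / 100 := by nlinarith
      have haa : a * a ≤ 81 / 100 := by nlinarith
      have hxxx : x ^ 2 * x ≤ 729 / 1000 := by nlinarith
      have hxxa : x ^ 2 * a ≤ 729 / 1000 := by nlinarith
      have hxaa : x * a ^ 2 ≤ 729 / 1000 := by nlinarith
      have haaa : a ^ 2 * a ≤ 729 / 1000 := by nlinarith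
      nlinarith [mul_nonneg (sub_nonneg.2 h₂) (sub_nonneg.2 ha₁)]
    rcases le_total x (18 / 5) with h₄ | h₄
    · nlinarith [mul_nonneg (sub_nonneg.2 h₃) (sub_nonneg.2 h₄),
        mul_nonneg (mul_nonneg (sub_nonneg.2 h₃) (sub_nonneg.2 h₄)) (sub_nonneg.2 h₃),
        mul_nonneg (mul_nonneg (sub_nonneg.2 h₃) (sub_nonneg.2 h₄)) (sub_nonneg.2 h₄),
        mul_nonneg (mul_nonneg (sub_nonneg.2 h₃) (sub_nonneg.2 h₄)) (sq_nonneg (x - 2)),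
        mul_nonneg (mul_nonneg (sub_nonneg.2 h₃) (sub_nonneg.2 h₄)) (sq_nonneg x)]
    · obtain ⟨u, hu, rfl⟩ : ∃ u, 0 ≤ u ∧ x = 18 / 5 + u := ⟨x - 18 / 5, by linarith, by ring⟩
      obtain ⟨v, hv, rfl⟩ : ∃ v, 0 ≤ v ∧ b = 18 / 5 + v := ⟨b - 18 / 5, by linarith, by ring⟩
      ring_nf at hxb
      have hpos : 0 ≤ u * v := by positivity
      have hpos₁ : 0 ≤ u ^ 2 * v := by positivity
      have hpos₂ : 0 ≤ u * v ^ 2 := by positivity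
      have hpos₃ : 0 ≤ u ^ 3 := by positivity
      have hpos₄ : 0 ≤ v ^ 3 := by positivity
      linarith [sq_nonneg u, sq_nonneg v]
  · rintro x (rfl | rfl)
    exacts [ha, hb]
end

section
/- The quartic polynomial Q(y) = 403 y⁴ − 1494 y³ + 1811 y² − 792 y + 112 has exactly four distinct real roots, and all four roots are positive. -/
open Polynomial in
/-- A real quartic equation with nonzero leading coefficient has at most four solutions. -/
theorem encard_quartic_zeros_le {a : ℝ} (ha : a ≠ 0) (b c d e : ℝ) :
    {y : ℝ | a * y ^ 4 + b * y ^ 3 + c * y ^ 2 + d * y + e = 0}.encard ≤ 4 := by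
  set p : ℝ[X] := C a * X ^ 4 + C b * X ^ 3 + C c * X ^ 2 + C d * X + C e with hp
  have hdeg : p.natDegree = 4 := by
    rw [hp]
    compute_degree!
  have hp0 : p ≠ 0 := ne_zero_of_natDegree_gt (n := 0) (by omega)
  have hset : {y : ℝ | a * y ^ 4 + b * y ^ 3 + c * y ^ 2 + d * y + e = 0} =
      (p.roots.toFinset : Set ℝ) := by
    ext y
    simp only [Set.mem_ofPred_eq, Finset.mem_coe, Multiset.mem_toFinset, mem_roots hp0,
      IsRoot.def]
    simp [hp]
  rw [hset, Set.encard_coe_eq_coe_finsetCard]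
  have hcard := (Multiset.toFinset_card_le p.roots).trans (p.card_roots'.trans hdeg.le)
  exact_mod_cast hcard

theorem stmt_4 :
    {y : ℝ | 403 * y ^ 4 - 1494 * y ^ 3 + 1811 * y ^ 2 - 792 * y + 112 = 0}.encard = 4 ∧
    ∀ y : ℝ, 403 * y ^ 4 - 1494 * y ^ 3 + 1811 * y ^ 2 - 792 * y + 112 = 0 → 0 < y := by
  constructor
  · apply le_antisymm
    · simpa [sub_eq_add_neg] using
        encard_quartic_zeros_le (a := 403) (by norm_num) (-1494) 1811 (-792) 112
    · let f : ℝ → ℝ := fun y ↦ 403 * y ^ 4 - 1494 * y ^ 3 + 1811 * y ^ 2 - 792 * y + 112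
      have hf : Continuous f := by fun_prop
      obtain ⟨r, ⟨-, hr⟩, hr0⟩ : (0 : ℝ) ∈ f '' Set.Ioo 0 0.35 :=
        intermediate_value_Ioo' (by norm_num) hf.continuousOn (by norm_num [f])
      obtain ⟨s, ⟨hs, hs'⟩, hs0⟩ : (0 : ℝ) ∈ f '' Set.Ioo 0.35 1 :=
        intermediate_value_Ioo (by norm_num) hf.continuousOn (by norm_num [f])
      obtain ⟨t, ⟨ht, ht'⟩, ht0⟩ : (0 : ℝ) ∈ f '' Set.Ioo 1 1.5 :=
        intermediate_value_Ioo' (by norm_num) hf.continuousOn (by norm_num [f])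
      obtain ⟨u, ⟨hu, -⟩, hu0⟩ : (0 : ℝ) ∈ f '' Set.Ioo 1.5 2 :=
        intermediate_value_Ioo (by norm_num) hf.continuousOn (by norm_num [f])
      have hrs := hr.trans hs
      have hst := hs'.trans ht
      have htu := ht'.trans hu
      have hcard : ({r, s, t, u} : Finset ℝ).card = 4 := by
        simp [hrs.ne, hst.ne, htu.ne, (hrs.trans hst).ne, (hst.trans htu).ne,
          (hrs.trans (hst.trans htu)).ne]
      have hsub : (({r, s, t, u} : Finset ℝ) : Set ℝ) ⊆ {y : ℝ | f y = 0} := by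
        simp [Set.insert_subset_iff, hr0, hs0, ht0, hu0]
      have hle := Set.encard_le_encard hsub
      rw [Set.encard_coe_eq_coe_finsetCard, hcard] at hle
      exact_mod_cast hle
  · intro y hy
    by_contra! h
    nlinarith [pow_nonneg (neg_nonneg.2 h) 3, sq_nonneg y, sq_nonneg (y ^ 2)]
end

section
/- For all real numbers p, q ≥ 1, one has p q (p + q)² < ((p + q)² − 1)(2pq + 1); consequently, the quadratic equation ((p + q)² − 1) p y² − 4 p q (p + q) y + 2 q (2pq + 1) = 0 has no real solution. -/
theorem stmt_12 (p q : ℝ) (hp : 1 ≤ p) (hq : 1 ≤ q) :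
    p * q * (p + q) ^ 2 < ((p + q) ^ 2 - 1) * (2 * p * q + 1) ∧
    ¬∃ y : ℝ,
        ((p + q) ^ 2 - 1) * p * y ^ 2 - 4 * p * q * (p + q) * y + 2 * q * (2 * p * q + 1) = 0 := by
  have hpq : 0 < p * q := by positivity
  have hsq : 0 < p ^ 2 + q ^ 2 - 1 := by nlinarith
  constructor
  · have h : 0 < p * q * (p + q) ^ 2 := by positivity
    linear_combination h + hsq
  · rintro ⟨y, hy⟩
    have hsum : (((p + q) ^ 2 - 1) * p * y - 2 * p * q * (p + q)) ^ 2
        + 2 * (p * q * (p ^ 2 + q ^ 2 - 1)) = 0 := by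
      linear_combination ((p + q) ^ 2 - 1) * p * hy
    have hpos : 0 < p * q * (p ^ 2 + q ^ 2 - 1) := mul_pos hpq hsq
    linarith [sq_nonneg (((p + q) ^ 2 - 1) * p * y - 2 * p * q * (p + q))]
end

section
/- For every natural number p ≥ 1 and every real number x, one has (48p³ + 84p² + 48p + 9) x⁴ − (224p³ + 528p² + 400p + 96) x³ + (400p³ + 1232p² + 1184p + 366) x² − (320p³ + 1248p² + 1504p + 576) x + (96p³ + 464p² + 704p + 320) > 0; in particular, this quartic has no real roots. -/
theorem quartic_pos (p x : ℝ) (hp : 1 ≤ p) :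
    0 < (48 * p ^ 3 + 84 * p ^ 2 + 48 * p + 9) * x ^ 4
        - (224 * p ^ 3 + 528 * p ^ 2 + 400 * p + 96) * x ^ 3
        + (400 * p ^ 3 + 1232 * p ^ 2 + 1184 * p + 366) * x ^ 2
        - (320 * p ^ 3 + 1248 * p ^ 2 + 1504 * p + 576) * x
        + (96 * p ^ 3 + 464 * p ^ 2 + 704 * p + 320) := by
  obtain ⟨q, rfl⟩ : ∃ q, p = q + 1 := ⟨p - 1, by ring⟩
  obtain ⟨t, rfl⟩ : ∃ t, x = t + 1 := ⟨x - 1, by ring⟩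
  have hq : 0 ≤ q := by linarith
  have h₀ : 0 < 189 * t ^ 4 - 492 * t ^ 3 + 572 * t ^ 2 - 272 * t + 59 := by
    nlinarith [sq_nonneg (t ^ 2 - 82 / 63 * t + 3 / 10), sq_nonneg (t - 9 / 20)]
  have h₁ : 0 ≤ 360 * t ^ 4 - 688 * t ^ 3 + 624 * t ^ 2 - 208 * t + 40 := by
    nlinarith [sq_nonneg (t ^ 2 - 43 / 45 * t + 3 / 20), sq_nonneg (t - 7 / 25)]
  have h₂ : 0 ≤ 228 * t ^ 4 - 288 * t ^ 3 + 200 * t ^ 2 - 32 * t + 4 := by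
    nlinarith [sq_nonneg (t ^ 2 - 12 / 19 * t), sq_nonneg (t - 4 / 25)]
  have h₃ : 0 ≤ 48 * t ^ 4 - 32 * t ^ 3 + 16 * t ^ 2 := by
    nlinarith [sq_nonneg (t ^ 2 - 1 / 3 * t), sq_nonneg t]
  have h := add_pos_of_pos_of_nonneg h₀ (add_nonneg (mul_nonneg hq h₁)
    (add_nonneg (mul_nonneg (pow_nonneg hq 2) h₂) (mul_nonneg (pow_nonneg hq 3) h₃)))
  linear_combination h


theorem stmt_14 (p : ℕ) (hp : 1 ≤ p) :
    (∀ x : ℝ,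
      0 < (48 * (p : ℝ) ^ 3 + 84 * p ^ 2 + 48 * p + 9) * x ^ 4
          - (224 * (p : ℝ) ^ 3 + 528 * p ^ 2 + 400 * p + 96) * x ^ 3
          + (400 * (p : ℝ) ^ 3 + 1232 * p ^ 2 + 1184 * p + 366) * x ^ 2
          - (320 * (p : ℝ) ^ 3 + 1248 * p ^ 2 + 1504 * p + 576) * x
          + (96 * (p : ℝ) ^ 3 + 464 * p ^ 2 + 704 * p + 320)) ∧
    ¬∃ x : ℝ,
      (48 * (p : ℝ) ^ 3 + 84 * p ^ 2 + 48 * p + 9) * x ^ 4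
          - (224 * (p : ℝ) ^ 3 + 528 * p ^ 2 + 400 * p + 96) * x ^ 3
          + (400 * (p : ℝ) ^ 3 + 1232 * p ^ 2 + 1184 * p + 366) * x ^ 2
          - (320 * (p : ℝ) ^ 3 + 1248 * p ^ 2 + 1504 * p + 576) * x
          + (96 * (p : ℝ) ^ 3 + 464 * p ^ 2 + 704 * p + 320) = 0 := by
  have h (x : ℝ) := quartic_pos p x (by exact_mod_cast hp)
  exact ⟨h, fun ⟨x, hx⟩ => (h x).ne' hx⟩
end

section
/- For every natural number m ≥ 6, the quartic polynomial p_m(z) = 4m⁴(m+2) z⁴ − 2m²(m³ + 6m² + 6m − 1) z³ + m(2m⁴ − 11m³ − 2m² + 13m − 2) z² + (m⁵ − 8m⁴ + 12m³ − 2m² − 5m + 2) z − (m⁴ − 4m³ + 6m² − 4m + 1) has exactly one positive real root. -/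
/-- A condition under which `(a z⁴ - b z³ + c z² + d z - e) / z` has positive difference quotients
on the positive reals, so that the quartic has at most one positive zero. -/
theorem quartic_pos_root_unique_of_quartic_pos {a b c d e : ℝ} (ha : 0 < a) (he : 0 ≤ e)
    (h : ∀ s : ℝ, 0 < s → 0 < 3 * a * s ^ 4 - 4 * b * s ^ 3 + 4 * c * s ^ 2 + 16 * e)
    {x y : ℝ} (hx : 0 < x) (hy : 0 < y)
    (hpx : a * x ^ 4 - b * x ^ 3 + c * x ^ 2 + d * x - e = 0)
    (hpy : a * y ^ 4 - b * y ^ 3 + c * y ^ 2 + d * y - e = 0) : x = y := by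
  have hxy : 0 < x * y := mul_pos hx hy
  have hs : 0 < x + y := add_pos hx hy
  have key : (x - y) * (x * y * (a * (x ^ 2 + x * y + y ^ 2) - b * (x + y) + c) + e) = 0 := by
    linear_combination y * hpx - x * hpy
  have hpos : 0 < x * y * (a * (x ^ 2 + x * y + y ^ 2) - b * (x + y) + c) + e := by
    have h4 : 0 < (x + y) ^ 2 *
        (x * y * (a * (x ^ 2 + x * y + y ^ 2) - b * (x + y) + c) + e) := by
      have h1 := mul_pos hxy (h _ hs)
      have h2 : 0 ≤ a * (x * y) * (x + y) ^ 2 * (x - y) ^ 2 := by positivity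
      have h3 : 0 ≤ e * (x - y) ^ 2 := by positivity
      linarith
    exact pos_of_mul_pos_right h4 (by positivity)
  rcases mul_eq_zero.mp key with h0 | h0
  · linarith
  · exact absurd h0 hpos.ne'

/-- A condition under which `(a z⁴ - b z³ + c z² - d z - e) / z²` has positive difference quotients
on the positive reals, so that the quartic has at most one positive zero. -/
theorem quartic_pos_root_unique_of_cubic_pos {a b c d e : ℝ} (hd : 0 ≤ d) (he : 0 ≤ e)
    (h : ∀ s : ℝ, 0 < s → 0 < a * s ^ 4 - b * s ^ 3 + 16 * e)
    {x y : ℝ} (hx : 0 < x) (hy : 0 < y)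
    (hpx : a * x ^ 4 - b * x ^ 3 + c * x ^ 2 - d * x - e = 0)
    (hpy : a * y ^ 4 - b * y ^ 3 + c * y ^ 2 - d * y - e = 0) : x = y := by
  have hxy : 0 < x * y := mul_pos hx hy
  have hs : 0 < x + y := add_pos hx hy
  have key : (x - y) * ((x * y) ^ 2 * (a * (x + y) - b) + d * (x * y) + e * (x + y)) = 0 := by
    linear_combination y ^ 2 * hpx - x ^ 2 * hpy
  have hpos : 0 < (x * y) ^ 2 * (a * (x + y) - b) + d * (x * y) + e * (x + y) := by
    have h4 : 0 < (x + y) ^ 3 *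
        ((x * y) ^ 2 * (a * (x + y) - b) + d * (x * y) + e * (x + y)) := by
      have h1 := mul_pos (pow_pos hxy 2) (h _ hs)
      have h2 : 0 ≤ (x + y) ^ 3 * (d * (x * y)) := by positivity
      have h3 : 0 ≤ e * ((x - y) ^ 2 * ((x + y) ^ 2 + 4 * (x * y))) := by positivity
      linarith
    exact pos_of_mul_pos_right h4 (by positivity)
  rcases mul_eq_zero.mp key with h0 | h0
  · linarith
  · exact absurd h0 hpos.ne'

theorem stmt_16 (m : ℕ) (hm : 6 ≤ m) :
    ∃! z : ℝ, 0 < z ∧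
      4 * (m : ℝ) ^ 4 * (m + 2) * z ^ 4
        - 2 * (m : ℝ) ^ 2 * ((m : ℝ) ^ 3 + 6 * m ^ 2 + 6 * m - 1) * z ^ 3
        + (m : ℝ) * (2 * (m : ℝ) ^ 4 - 11 * m ^ 3 - 2 * m ^ 2 + 13 * m - 2) * z ^ 2
        + ((m : ℝ) ^ 5 - 8 * m ^ 4 + 12 * m ^ 3 - 2 * m ^ 2 - 5 * m + 2) * z
        - ((m : ℝ) ^ 4 - 4 * m ^ 3 + 6 * m ^ 2 - 4 * m + 1) = 0 := by
  have hm6 : (6 : ℝ) ≤ m := by exact_mod_cast hm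
  have he : (0 : ℝ) < (m : ℝ) ^ 4 - 4 * m ^ 3 + 6 * m ^ 2 - 4 * m + 1 := by
    have : (0 : ℝ) < ((m : ℝ) - 1) ^ 4 := pow_pos (by linarith) 4
    linarith
  refine existsUnique_of_exists_of_unique ?_ ?_
  · set p : ℝ → ℝ := fun z ↦ 4 * (m : ℝ) ^ 4 * (m + 2) * z ^ 4
        - 2 * (m : ℝ) ^ 2 * ((m : ℝ) ^ 3 + 6 * m ^ 2 + 6 * m - 1) * z ^ 3
        + (m : ℝ) * (2 * (m : ℝ) ^ 4 - 11 * m ^ 3 - 2 * m ^ 2 + 13 * m - 2) * z ^ 2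
        + ((m : ℝ) ^ 5 - 8 * m ^ 4 + 12 * m ^ 3 - 2 * m ^ 2 - 5 * m + 2) * z
        - ((m : ℝ) ^ 4 - 4 * m ^ 3 + 6 * m ^ 2 - 4 * m + 1) with hp
    have hcont : Continuous p := by fun_prop
    have h0 : p 0 < 0 := by simp only [hp]; linarith
    have h1 : 0 < p 1 := by
      obtain ⟨n, hn⟩ : ∃ n : ℝ, n = m - 6 := ⟨_, rfl⟩
      have hn0 : 0 ≤ n := by linarith
      have hmn : (m : ℝ) = n + 6 := by linarith
      simp only [hp, hmn]
      ring_nf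
      positivity
    obtain ⟨z, hz, hpz⟩ := intermediate_value_Ioo zero_le_one hcont.continuousOn ⟨h0, h1⟩
    exact ⟨z, hz.1, hpz⟩
  · rintro x y ⟨hx, hpx⟩ ⟨hy, hpy⟩
    rcases hm.eq_or_lt with rfl | hm7
    · refine quartic_pos_root_unique_of_cubic_pos (a := 41472) (b := 33624) (c := 1320) (d := 100)
        (e := 625) (by norm_num) (by norm_num) (fun s hs ↦ ?_) hx hy ?_ ?_
      · nlinarith [sq_nonneg (s ^ 2 - 2 / 5 * s - 1 / 10), sq_nonneg (s - 3 / 5),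
          sq_nonneg (s * (s - 3 / 5))]
      · norm_num at hpx; linarith
      · norm_num at hpy; linarith
    · refine quartic_pos_root_unique_of_quartic_pos (by positivity) he.le (fun s hs ↦ ?_)
        hx hy hpx hpy
      rcases lt_or_ge m 10 with hm10 | hm10
      · interval_cases m <;> norm_num <;>
          nlinarith [sq_nonneg (s ^ 2 - 2 / 5 * s - 1 / 10), sq_nonneg (s - 7 / 10),
            sq_nonneg (s * (s - 7 / 10))]
      · obtain ⟨n, rfl⟩ := Nat.exists_eq_add_of_le' hm10
        have hdisc : 0 < 3 * (4 * ((n + 10 : ℕ) : ℝ) ^ 4 * ((n + 10 : ℕ) + 2))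
            * (((n + 10 : ℕ) : ℝ) * (2 * ((n + 10 : ℕ) : ℝ) ^ 4 - 11 * (n + 10 : ℕ) ^ 3
              - 2 * (n + 10 : ℕ) ^ 2 + 13 * (n + 10 : ℕ) - 2))
            - (2 * ((n + 10 : ℕ) : ℝ) ^ 2 * (((n + 10 : ℕ) : ℝ) ^ 3 + 6 * (n + 10 : ℕ) ^ 2
              + 6 * (n + 10 : ℕ) - 1)) ^ 2 := by
          push_cast
          ring_nf
          positivity
        have ha : 0 < 4 * ((n + 10 : ℕ) : ℝ) ^ 4 * ((n + 10 : ℕ) + 2) := by positivity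
        generalize 4 * ((n + 10 : ℕ) : ℝ) ^ 4 * ((n + 10 : ℕ) + 2) = a at *
        generalize 2 * ((n + 10 : ℕ) : ℝ) ^ 2 * (((n + 10 : ℕ) : ℝ) ^ 3 + 6 * (n + 10 : ℕ) ^ 2
              + 6 * (n + 10 : ℕ) - 1) = b at *
        generalize ((n + 10 : ℕ) : ℝ) * (2 * ((n + 10 : ℕ) : ℝ) ^ 4 - 11 * (n + 10 : ℕ) ^ 3
              - 2 * (n + 10 : ℕ) ^ 2 + 13 * (n + 10 : ℕ) - 2) = c at *
        have hq : 0 < 3 * a * s ^ 2 - 4 * b * s + 4 * c := by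
          refine pos_of_mul_pos_right (a := 3 * a) ?_ (by positivity)
          linarith [sq_nonneg (3 * a * s - 2 * b)]
        linarith [mul_pos (pow_pos hs 2) hq]
end

section
/- For every natural number m ≥ 7, one has p_m(1/(m−6)) > 0, where p_m(z) = 4m⁴(m+2) z⁴ − 2m²(m³ + 6m² + 6m − 1) z³ + m(2m⁴ − 11m³ − 2m² + 13m − 2) z² + (m⁵ − 8m⁴ + 12m³ − 2m² − 5m + 2) z − (m⁴ − 4m³ + 6m² − 4m + 1). -/
theorem stmt_17 (m : ℕ) (hm : 7 ≤ m) :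
    let p : ℝ → ℝ := fun z =>
      4 * (m : ℝ) ^ 4 * (m + 2) * z ^ 4
        - 2 * (m : ℝ) ^ 2 * ((m : ℝ) ^ 3 + 6 * m ^ 2 + 6 * m - 1) * z ^ 3
        + (m : ℝ) * (2 * (m : ℝ) ^ 4 - 11 * m ^ 3 - 2 * m ^ 2 + 13 * m - 2) * z ^ 2
        + ((m : ℝ) ^ 5 - 8 * m ^ 4 + 12 * m ^ 3 - 2 * m ^ 2 - 5 * m + 2) * z
        - ((m : ℝ) ^ 4 - 4 * m ^ 3 + 6 * m ^ 2 - 4 * m + 1)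
    0 < p (1 / ((m : ℝ) - 6)) := by
  intro p
  obtain ⟨n, rfl⟩ := Nat.exists_eq_add_of_le hm
  obtain ⟨k, hk⟩ : ∃ k : ℝ, k = n := ⟨_, rfl⟩
  have hk0 : 0 ≤ k := hk ▸ n.cast_nonneg
  have hk1 : k + 1 ≠ 0 := by positivity
  have key : p (1 / (((7 + n : ℕ) : ℝ) - 6)) =
      (4 * k ^ 7 + 105 * k ^ 6 + 1078 * k ^ 5 + 5194 * (k ^ 2 - 1) ^ 2
        + 9756 * ((k - 1) ^ 2 * (k + 2)) + 4869 * k ^ 2 + 4158 * k + 2714) / (k + 1) ^ 4 := by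
    have hz : ((7 + n : ℕ) : ℝ) - 6 = k + 1 := by push_cast; rw [hk]; ring
    rw [hz]
    simp only [p]
    push_cast
    rw [← hk]
    field_simp
    ring
  rw [key]
  positivity
end

section
/- Let c₁ > 1, d > 0, n₁ > 0, n₂ > 0 and Λ ≥ 0 be real numbers, set c₂ = c₁/(c₁−1) and n = n₁ + n₂ + d, and define, for z > 0, F(z) = ( d(2c₁c₂z² + c₂z⁴ + c₁)/(4(c₂z² + c₁)z) + n₁/(4z) + n₂ z/4 − c₁c₂Λ z/(2(c₂z² + c₁)) ) · z^((n₁−n₂)/n) · ( (c₁+c₂)² (c₂²z² + c₁²) z / ((c₁² + c₂²)(c₂z² + c₁)²) )^(d/n). Then F(z) → +∞ as z → 0⁺ and F(z) → +∞ as z → +∞; consequently, F attains a global minimum on (0, ∞). -/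
open Filter Topology Set

/-- A continuous function on `(0, ∞)` which diverges to `+∞` at both ends attains its minimum. -/
theorem exists_forall_le_of_tendsto_atTop_Ioi {f : ℝ → ℝ} (hf : ContinuousOn f (Ioi 0))
    (h₀ : Tendsto f (𝓝[>] 0) atTop) (h₁ : Tendsto f atTop atTop) :
    ∃ z₀ ∈ Ioi (0 : ℝ), ∀ z ∈ Ioi (0 : ℝ), f z₀ ≤ f z := by
  have hcont : Continuous (f ∘ Real.exp) :=
    hf.comp_continuous Real.continuous_exp Real.exp_pos
  have hlim : Tendsto (f ∘ Real.exp) (cocompact ℝ) atTop := by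
    rw [cocompact_eq_atBot_atTop]
    exact (h₀.comp Real.tendsto_exp_atBot_nhdsGT).sup (h₁.comp Real.tendsto_exp_atTop)
  obtain ⟨t, ht⟩ := hcont.exists_forall_le hlim
  refine ⟨Real.exp t, Real.exp_pos t, fun z hz => ?_⟩
  simpa [Real.exp_log hz] using ht (Real.log z)

/-- The normalized scalar curvature of the normal metric `(z, 1/z)`. -/
noncomputable def normalizedScal (c₁ c₂ d n₁ n₂ Λ z : ℝ) : ℝ :=
  (d * (2 * c₁ * c₂ * z ^ 2 + c₂ * z ^ 4 + c₁) / (4 * (c₂ * z ^ 2 + c₁) * z)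
      + n₁ / (4 * z) + n₂ * z / 4
      - c₁ * c₂ * Λ * z / (2 * (c₂ * z ^ 2 + c₁)))
    * z ^ ((n₁ - n₂) / (n₁ + n₂ + d))
    * ((c₁ + c₂) ^ 2 * (c₂ ^ 2 * z ^ 2 + c₁ ^ 2) * z
        / ((c₁ ^ 2 + c₂ ^ 2) * (c₂ * z ^ 2 + c₁) ^ 2)) ^ (d / (n₁ + n₂ + d))

namespace normalizedScal

variable {c₁ c₂ d n₁ n₂ : ℝ}

theorem continuousOn (hc₁ : 0 < c₁) (hc₂ : 0 < c₂) (Λ : ℝ) :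
    ContinuousOn (normalizedScal c₁ c₂ d n₁ n₂ Λ) (Ioi 0) := by
  intro z hz
  have hz : 0 < z := hz
  apply ContinuousAt.continuousWithinAt
  unfold normalizedScal
  have hbase : (c₁ + c₂) ^ 2 * (c₂ ^ 2 * z ^ 2 + c₁ ^ 2) * z
        / ((c₁ ^ 2 + c₂ ^ 2) * (c₂ * z ^ 2 + c₁) ^ 2) ≠ 0 := by positivity
  refine ContinuousAt.mul (ContinuousAt.mul ?_ ?_) (ContinuousAt.rpow_const ?_ (Or.inl hbase))
  · fun_prop (disch := positivity)
  · exact Real.continuousAt_rpow_const _ _ (Or.inl hz.ne')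
  · fun_prop (disch := positivity)

/-- Exchanging the two factors of the product amounts to inverting `z`. -/
theorem inv_eq_swap (hc₁ : 0 < c₁) (hc₂ : 0 < c₂) (Λ : ℝ) {z : ℝ} (hz : 0 < z) :
    normalizedScal c₁ c₂ d n₁ n₂ Λ z⁻¹ = normalizedScal c₂ c₁ d n₂ n₁ Λ z := by
  unfold normalizedScal
  have hpos₁ : c₂ * z⁻¹ ^ 2 + c₁ = (c₁ * z ^ 2 + c₂) / z ^ 2 := by field_simp; ring
  have hne : c₁ * z ^ 2 + c₂ ≠ 0 := by positivity
  have hsq : c₁ ^ 2 + c₂ ^ 2 ≠ 0 := by positivity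
  have hsq' : c₂ ^ 2 + c₁ ^ 2 ≠ 0 := by positivity
  congr 1
  · congr 1
    · rw [hpos₁]
      field_simp
      ring
    · rw [Real.inv_rpow hz.le, ← Real.rpow_neg hz.le]
      congr 1
      ring
  · rw [add_comm n₂ n₁, hpos₁]
    congr 1
    field_simp
    ring

theorem tendsto_nhdsGT_zero (hc₁ : 0 < c₁) (hc₂ : 0 < c₂) (hd : 0 < d) (hn₁ : 0 < n₁)
    (hn₂ : 0 < n₂) (Λ : ℝ) :
    Tendsto (normalizedScal c₁ c₂ d n₁ n₂ Λ) (𝓝[>] 0) atTop := by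
  have hn : 0 < n₁ + n₂ + d := by positivity
  let A : ℝ → ℝ := fun z =>
    d * (2 * c₁ * c₂ * z ^ 2 + c₂ * z ^ 4 + c₁) / (4 * (c₂ * z ^ 2 + c₁))
      + n₁ / 4 + n₂ * z ^ 2 / 4 - c₁ * c₂ * Λ * z ^ 2 / (2 * (c₂ * z ^ 2 + c₁))
  let B : ℝ → ℝ := fun z =>
    (c₁ + c₂) ^ 2 * (c₂ ^ 2 * z ^ 2 + c₁ ^ 2) / ((c₁ ^ 2 + c₂ ^ 2) * (c₂ * z ^ 2 + c₁) ^ 2)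
  have hB_pos (z : ℝ) : 0 < B z := by positivity
  have hA : Tendsto A (𝓝[>] 0) (𝓝 (A 0)) := by
    have : Continuous A := by fun_prop (disch := intros; positivity)
    exact this.continuousWithinAt
  have hB : Tendsto (fun z => B z ^ (d / (n₁ + n₂ + d))) (𝓝[>] 0)
      (𝓝 (B 0 ^ (d / (n₁ + n₂ + d)))) := by
    have : Continuous B := by fun_prop (disch := intros; positivity)
    exact this.continuousWithinAt.rpow_const (Or.inl (hB_pos 0).ne')
  have hA₀ : 0 < A 0 := by
    have : A 0 = d * c₁ / (4 * c₁) + n₁ / 4 := by simp [A]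
    rw [this]
    positivity
  have hz : Tendsto (fun z : ℝ => z ^ (-(2 * n₂ / (n₁ + n₂ + d)))) (𝓝[>] 0) atTop :=
    tendsto_rpow_neg_nhdsGT_zero (neg_lt_zero.2 (by positivity))
  refine ((hz.atTop_mul_pos (mul_pos hA₀ (Real.rpow_pos_of_pos (hB_pos 0) _))
    (hA.mul hB)).congr' ?_)
  filter_upwards [self_mem_nhdsWithin] with z (hz : 0 < z)
  have hne : c₂ * z ^ 2 + c₁ ≠ 0 := by positivity
  have hexp : z ^ (-(2 * n₂ / (n₁ + n₂ + d))) =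
      z⁻¹ * z ^ ((n₁ - n₂) / (n₁ + n₂ + d)) * z ^ (d / (n₁ + n₂ + d)) := by
    rw [← Real.rpow_neg_one, ← Real.rpow_add hz, ← Real.rpow_add hz]
    congr 1
    field_simp
    ring
  have hbracket : d * (2 * c₁ * c₂ * z ^ 2 + c₂ * z ^ 4 + c₁) / (4 * (c₂ * z ^ 2 + c₁) * z)
      + n₁ / (4 * z) + n₂ * z / 4 - c₁ * c₂ * Λ * z / (2 * (c₂ * z ^ 2 + c₁)) = A z * z⁻¹ := by
    simp only [A]
    field_simp
  have hbase : (c₁ + c₂) ^ 2 * (c₂ ^ 2 * z ^ 2 + c₁ ^ 2) * z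
      / ((c₁ ^ 2 + c₂ ^ 2) * (c₂ * z ^ 2 + c₁) ^ 2) = B z * z := by
    simp only [B]
    ring
  rw [normalizedScal, hbracket, hbase, Real.mul_rpow (hB_pos z).le hz.le, hexp]
  ring

theorem tendsto_atTop (hc₁ : 0 < c₁) (hc₂ : 0 < c₂) (hd : 0 < d) (hn₁ : 0 < n₁)
    (hn₂ : 0 < n₂) (Λ : ℝ) :
    Tendsto (normalizedScal c₁ c₂ d n₁ n₂ Λ) atTop atTop := by
  refine ((tendsto_nhdsGT_zero hc₂ hc₁ hd hn₂ hn₁ Λ).comp tendsto_inv_atTop_nhdsGT_zero).congr' ?_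
  filter_upwards [eventually_gt_atTop 0] with z hz
  exact inv_eq_swap hc₂ hc₁ Λ hz

end normalizedScal


theorem stmt_19 (c₁ d n₁ n₂ Λ : ℝ) (hc : 1 < c₁) (hd : 0 < d) (hn₁ : 0 < n₁)
    (hn₂ : 0 < n₂) (hΛ : 0 ≤ Λ) :
    let c₂ : ℝ := c₁ / (c₁ - 1)
    let n : ℝ := n₁ + n₂ + d
    let F : ℝ → ℝ := fun z =>
      (d * (2 * c₁ * c₂ * z ^ 2 + c₂ * z ^ 4 + c₁) / (4 * (c₂ * z ^ 2 + c₁) * z)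
          + n₁ / (4 * z) + n₂ * z / 4
          - c₁ * c₂ * Λ * z / (2 * (c₂ * z ^ 2 + c₁)))
        * z ^ ((n₁ - n₂) / n)
        * ((c₁ + c₂) ^ 2 * (c₂ ^ 2 * z ^ 2 + c₁ ^ 2) * z
            / ((c₁ ^ 2 + c₂ ^ 2) * (c₂ * z ^ 2 + c₁) ^ 2)) ^ (d / n)
    Filter.Tendsto F (nhdsWithin 0 (Set.Ioi 0)) Filter.atTop ∧
    Filter.Tendsto F Filter.atTop Filter.atTop ∧
    ∃ z₀ ∈ Set.Ioi (0 : ℝ), ∀ z ∈ Set.Ioi (0 : ℝ), F z₀ ≤ F z := by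
  intro c₂ n F
  have hc₁ : 0 < c₁ := by linarith
  have hc₂ : 0 < c₂ := div_pos hc₁ (by linarith)
  have h₀ : Filter.Tendsto F (𝓝[>] 0) atTop :=
    normalizedScal.tendsto_nhdsGT_zero hc₁ hc₂ hd hn₁ hn₂ Λ
  have h₁ : Filter.Tendsto F atTop atTop :=
    normalizedScal.tendsto_atTop hc₁ hc₂ hd hn₁ hn₂ Λ
  exact ⟨h₀, h₁, exists_forall_le_of_tendsto_atTop_Ioi
    (normalizedScal.continuousOn hc₁ hc₂ Λ) h₀ h₁⟩
end
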